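/- arXiv:1207.1954 — 2 statements merged into one kernel-verified Lean document; each statement's English description precedes it below -/
import Mathlib

section
/- Let V and W be Seifert matrices in M_{2g}(ℚ) such that W = Δ_n V Δ_n, where n or 1/n is a positive integer. Then there exist an enlargement Ṽ of V, an enlargement W̃ of W (both of size 2g+2), and an integral symplectic matrix P ∈ M_{2g+2}(ℤ) such that W̃ = P Ṽ Pᵗ. -/
open Matrix

/-- The standard symplectic `2g × 2g` matrix with `g` diagonal blocks `[[0,-1],[1,0]]`. -/
def Jmat (R : Type*) [CommRing R] (g : ℕ) : Matrix (Fin (2*g)) (Fin (2*g)) R :=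
  Matrix.of fun i j =>
    if i.val % 2 = 0 ∧ j.val = i.val + 1 then (-1 : R)
    else if j.val % 2 = 0 ∧ i.val = j.val + 1 then 1
    else 0

/-- A Seifert matrix: `V - Vᵀ = J`. -/
def IsSeifert {R : Type*} [CommRing R] {g : ℕ} (V : Matrix (Fin (2*g)) (Fin (2*g)) R) : Prop :=
  V - Vᵀ = Jmat R g

/-- A symplectic matrix: `P * J * Pᵀ = J`. -/
def IsSymplectic {R : Type*} [CommRing R] {g : ℕ} (P : Matrix (Fin (2*g)) (Fin (2*g)) R) : Prop :=
  P * Jmat R g * Pᵀ = Jmat R g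

/-- A rational matrix with integer entries. -/
def IsIntegralMat {n : ℕ} (P : Matrix (Fin n) (Fin n) ℚ) : Prop :=
  ∀ i j, ∃ m : ℤ, P i j = (m : ℚ)

/-- Row enlargement `[[0,0,0],[1,x,ρᵗ],[0,ρ,V]]` of a matrix `V`. -/
def rowEnl {R : Type*} [CommRing R] {g : ℕ} (V : Matrix (Fin (2*g)) (Fin (2*g)) R)
    (x : R) (ρ : Fin (2*g) → R) : Matrix (Fin (2*(g+1))) (Fin (2*(g+1))) R :=
  Matrix.of fun i j =>
    if hi : 2 ≤ i.val then
      if hj : 2 ≤ j.val then V ⟨i.val - 2, by have := i.2; omega⟩ ⟨j.val - 2, by have := j.2; omega⟩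
      else if j.val = 1 then ρ ⟨i.val - 2, by have := i.2; omega⟩ else 0
    else
      if i.val = 0 then 0
      else
        if hj : 2 ≤ j.val then ρ ⟨j.val - 2, by have := j.2; omega⟩
        else if j.val = 0 then 1 else x

/-- Column enlargement `[[0,-1,0],[0,x,ρᵗ],[0,ρ,V]]` of a matrix `V`. -/
def colEnl {R : Type*} [CommRing R] {g : ℕ} (V : Matrix (Fin (2*g)) (Fin (2*g)) R)
    (x : R) (ρ : Fin (2*g) → R) : Matrix (Fin (2*(g+1))) (Fin (2*(g+1))) R :=
  Matrix.of fun i j =>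
    if hi : 2 ≤ i.val then
      if hj : 2 ≤ j.val then V ⟨i.val - 2, by have := i.2; omega⟩ ⟨j.val - 2, by have := j.2; omega⟩
      else if j.val = 1 then ρ ⟨i.val - 2, by have := i.2; omega⟩ else 0
    else
      if i.val = 0 then (if j.val = 1 then -1 else 0)
      else
        if hj : 2 ≤ j.val then ρ ⟨j.val - 2, by have := j.2; omega⟩
        else if j.val = 0 then 0 else x

/-- `W` is an enlargement (row or column) of `V`. -/
def IsEnlargement {R : Type*} [CommRing R] {g : ℕ} (V : Matrix (Fin (2*g)) (Fin (2*g)) R)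
    (W : Matrix (Fin (2*(g+1))) (Fin (2*(g+1))) R) : Prop :=
  ∃ (x : R) (ρ : Fin (2*g) → R), W = rowEnl V x ρ ∨ W = colEnl V x ρ

/-- The diagonal matrix `diag(n, n⁻¹, 1, …, 1)` of size `2g`. -/
def Delta (g : ℕ) (n : ℚ) : Matrix (Fin (2*g)) (Fin (2*g)) ℚ :=
  Matrix.diagonal (fun i => if i.val = 0 then n else if i.val = 1 then n⁻¹ else 1)

/-- The linear map sending a column `(u, t, v₁, v₂, v₃, …)` to
`(n t + v₁, v₂, -t, u + n v₂, v₃, …)`. -/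
def neighborMap {R : Type*} [CommRing R] (k : ℕ) (n : R)
    (f : Fin (2*(k+1+1)) → R) (i : Fin (2*(k+1+1))) : R :=
  if i.val = 0 then n * f ⟨1, by omega⟩ + f ⟨2, by omega⟩
  else if i.val = 1 then f ⟨3, by omega⟩
  else if i.val = 2 then -f ⟨1, by omega⟩
  else if i.val = 3 then f ⟨0, by omega⟩ + n * f ⟨3, by omega⟩
  else f i

/-- The matrix of `neighborMap k n`. -/
def neighborMat {R : Type*} [CommRing R] (k : ℕ) (n : R) :
    Matrix (Fin (2*(k+1+1))) (Fin (2*(k+1+1))) R :=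
  Matrix.of fun i j => neighborMap k n (Pi.single j 1) i

lemma neighborMat_dotProduct {R : Type*} [CommRing R] (k : ℕ) (n : R)
    (f : Fin (2*(k+1+1)) → R) (i : Fin (2*(k+1+1))) :
    neighborMat k n i ⬝ᵥ f = neighborMap k n f i := by
  change ∑ j, neighborMap k n (Pi.single j 1) i * f j = _
  unfold neighborMap
  split_ifs <;> simp [Pi.single_apply, add_mul, Finset.sum_add_distrib, -Fin.mk_one, -Fin.zero_eta]

lemma neighborMat_congr_apply {R : Type*} [CommRing R] (k : ℕ) (n : R)
    (M : Matrix (Fin (2*(k+1+1))) (Fin (2*(k+1+1))) R) (i j : Fin (2*(k+1+1))) :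
    (neighborMat k n * M * (neighborMat k n)ᵀ) i j =
      neighborMap k n (fun a => neighborMap k n (M a) j) i := by
  rw [Matrix.mul_assoc, ← neighborMat_dotProduct, Matrix.mul_apply']
  congr 1
  ext a
  rw [Matrix.mul_apply', ← neighborMat_dotProduct, dotProduct_comm]
  rfl

lemma fin_cases_four {k : ℕ} (i : Fin (2*(k+1+1))) :
    i = ⟨0, by omega⟩ ∨ i = ⟨1, by omega⟩ ∨ i = ⟨2, by omega⟩ ∨ i = ⟨3, by omega⟩ ∨
      ∃ (m : ℕ) (h : m < 2*k), i = ⟨m+4, by omega⟩ := by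
  obtain ⟨i, hi⟩ := i
  rcases i with _ | _ | _ | _ | m
  · simp
  · simp
  · simp
  · simp
  · exact .inr (.inr (.inr (.inr ⟨m, by omega, rfl⟩)))

lemma isSymplectic_neighborMat {R : Type*} [CommRing R] (k : ℕ) (n : R) :
    IsSymplectic (neighborMat k n) := by
  unfold IsSymplectic
  ext i j
  rw [neighborMat_congr_apply]
  obtain rfl | rfl | rfl | rfl | ⟨a, ha, rfl⟩ := fin_cases_four i <;>
  obtain rfl | rfl | rfl | rfl | ⟨b, hb, rfl⟩ := fin_cases_four j <;>
  simp [neighborMap, Jmat, -Fin.mk_one, -Fin.zero_eta]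

lemma isIntegralMat_neighborMat (k m : ℕ) : IsIntegralMat (neighborMat k (m : ℚ)) := by
  have hs : ∀ a b : Fin (2*(k+1+1)), ∃ z : ℤ, (Pi.single a (1 : ℚ) : _ → ℚ) b = z := by
    intro a b
    by_cases h : b = a
    · exact ⟨1, by simp [h]⟩
    · exact ⟨0, by simp [h]⟩
  intro i j
  choose z hz using hs j
  simp only [neighborMat, neighborMap, Matrix.of_apply, hz]
  split_ifs
  · exact ⟨m * z ⟨1, by omega⟩ + z ⟨2, by omega⟩, by push_cast; rfl⟩
  · exact ⟨_, rfl⟩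
  · exact ⟨-z ⟨1, by omega⟩, by push_cast; rfl⟩
  · exact ⟨z ⟨0, by omega⟩ + m * z ⟨3, by omega⟩, by push_cast; rfl⟩
  · exact ⟨_, rfl⟩

set_option maxHeartbeats 2000000 in
/-- The row enlargement of `V` whose `ρ` is `-1/n` times the first column of `V` is congruent, via
`neighborMat k n`, to a column enlargement of `Δ V Δ`, where `Δ = diag(1/n, n, 1, …, 1)`. -/
lemma colEnl_Delta_inv_congr {k : ℕ} (V : Matrix (Fin (2*(k+1))) (Fin (2*(k+1))) ℚ)
    (hV : IsSeifert V) (n : ℚ) (hn : n ≠ 0) :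
    ∃ (x y : ℚ) (ρ σ : Fin (2*(k+1)) → ℚ),
      colEnl (Delta (k+1) n⁻¹ * V * Delta (k+1) n⁻¹) y σ =
        neighborMat k n * rowEnl V x ρ * (neighborMat k n)ᵀ := by
  have hS : ∀ i j, V i j = V j i + Jmat ℚ (k+1) i j := fun i j => by
    have := congrFun (congrFun hV i) j
    rw [← this]
    simp
  have h01 := hS ⟨0, by omega⟩ ⟨1, by omega⟩
  have h0 : ∀ (a : ℕ) (ha : a < 2*k), V 0 ⟨a+2, by omega⟩ =
      V ⟨a+2, by omega⟩ 0 := fun a ha => by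
    rw [hS]; simp [Jmat, -Fin.mk_one, -Fin.zero_eta]
  have h1 : ∀ (a : ℕ) (ha : a < 2*k), V ⟨1, by omega⟩ ⟨a+2, by omega⟩ =
      V ⟨a+2, by omega⟩ ⟨1, by omega⟩ := fun a ha => by
    rw [hS]; simp [Jmat, -Fin.mk_one, -Fin.zero_eta]
  simp [Jmat, -Fin.mk_one, -Fin.zero_eta] at h01
  refine ⟨V ⟨0, by omega⟩ ⟨0, by omega⟩ / n ^ 2, V ⟨1, by omega⟩ ⟨1, by omega⟩,
    fun j => -V j ⟨0, by omega⟩ / n,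
    fun j => if j.val = 0 then V ⟨1, by omega⟩ ⟨0, by omega⟩ / n
      else if j.val = 1 then n * V ⟨1, by omega⟩ ⟨1, by omega⟩ else V ⟨1, by omega⟩ j, ?_⟩
  ext i j
  rw [neighborMat_congr_apply]
  obtain rfl | rfl | rfl | rfl | ⟨a, ha, rfl⟩ := fin_cases_four i <;>
  obtain rfl | rfl | rfl | rfl | ⟨b, hb, rfl⟩ := fin_cases_four j <;>
  simp [neighborMap, rowEnl, colEnl, Delta, Matrix.diagonal_mul, Matrix.mul_diagonal,
    -Fin.mk_one, -Fin.zero_eta] <;>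
  (try simp only [h0 _ ‹_ < 2*k›, h1 _ ‹_ < 2*k›]) <;> (try rw [h01]) <;> field_simp <;>
  first | ring1 | (right; ring1)

lemma Jmat_mul_self {R : Type*} [CommRing R] (g : ℕ) : Jmat R g * Jmat R g = -1 := by
  ext i j
  rw [Matrix.mul_apply]
  rcases Nat.mod_two_eq_zero_or_one i.val with hi | hi
  · rw [Finset.sum_eq_single (⟨i.val + 1, by omega⟩ : Fin (2*g))]
    · simp only [Jmat, Matrix.of_apply, Matrix.neg_apply, Matrix.one_apply, Fin.ext_iff, and_true]
      split_ifs <;> first | (exfalso; omega) | simp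
    · intro b _ hb
      simp only [ne_eq, Fin.ext_iff] at hb
      simp only [Jmat, Matrix.of_apply]
      split_ifs <;> first | (exfalso; omega) | simp
    · simp
  · rw [Finset.sum_eq_single (⟨i.val - 1, by omega⟩ : Fin (2*g))]
    · simp only [Jmat, Matrix.of_apply, Matrix.neg_apply, Matrix.one_apply, Fin.ext_iff]
      split_ifs <;> first | (exfalso; omega) | simp
    · intro b _ hb
      simp only [ne_eq, Fin.ext_iff] at hb
      simp only [Jmat, Matrix.of_apply]
      split_ifs <;> first | (exfalso; omega) | simp
    · simp

lemma isIntegralMat_iff {n : ℕ} (P : Matrix (Fin n) (Fin n) ℚ) :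
    IsIntegralMat P ↔ ∃ Q : Matrix (Fin n) (Fin n) ℤ, P = Q.map (Int.castRingHom ℚ) := by
  constructor
  · intro h
    choose Q hQ using h
    exact ⟨Matrix.of Q, by ext i j; simp [hQ]⟩
  · rintro ⟨Q, rfl⟩ i j
    exact ⟨Q i j, by simp⟩

lemma Jmat_map {R S : Type*} [CommRing R] [CommRing S] (f : R →+* S) (g : ℕ) :
    (Jmat R g).map f = Jmat S g := by
  ext i j
  simp only [Jmat, Matrix.map_apply, Matrix.of_apply]
  split_ifs <;> simp

/-- An integral symplectic matrix has an integral symplectic inverse. -/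
lemma IsSymplectic.exists_integral_inverse {g : ℕ} {P : Matrix (Fin (2*g)) (Fin (2*g)) ℚ}
    (hP : IsSymplectic P) (hI : IsIntegralMat P) :
    ∃ Q, IsIntegralMat Q ∧ IsSymplectic Q ∧ Q * P = 1 := by
  have hPQ : P * -(Jmat ℚ g * Pᵀ * Jmat ℚ g) = 1 := by
    rw [Matrix.mul_neg, ← Matrix.mul_assoc, ← Matrix.mul_assoc, hP, Jmat_mul_self, neg_neg]
  have hQP := mul_eq_one_comm.mp hPQ
  generalize hQ : -(Jmat ℚ g * Pᵀ * Jmat ℚ g) = Q at hPQ hQP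
  refine ⟨Q, ?_, ?_, hQP⟩
  · obtain ⟨P, rfl⟩ := (isIntegralMat_iff P).mp hI
    refine (isIntegralMat_iff Q).mpr ⟨-(Jmat ℤ g * Pᵀ * Jmat ℤ g), ?_⟩
    rw [← hQ, Matrix.map_neg _ (map_neg _), Matrix.map_mul, Matrix.map_mul, Jmat_map,
      Matrix.transpose_map]
  · have hPQt : Pᵀ * Qᵀ = 1 := by rw [← Matrix.transpose_mul, hQP, Matrix.transpose_one]
    calc Q * Jmat ℚ g * Qᵀ = Q * (P * Jmat ℚ g * Pᵀ) * Qᵀ := by rw [hP]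
      _ = (Q * P) * Jmat ℚ g * (Pᵀ * Qᵀ) := by simp only [Matrix.mul_assoc]
      _ = Jmat ℚ g := by rw [hQP, hPQt, Matrix.one_mul, Matrix.mul_one]

lemma Delta_mul_Delta_inv {n : ℚ} (hn : n ≠ 0) (g : ℕ) : Delta g n * Delta g n⁻¹ = 1 := by
  unfold Delta
  rw [Matrix.diagonal_mul_diagonal, ← Matrix.diagonal_one]
  congr 1
  ext i
  split_ifs <;> simp [hn]

/-- Lemma `lemmadelta`, first part: if `W = Δ_n V Δ_n` for Seifert
matrices `V, W`, where `n` or `1/n` is a positive integer, then some enlargements of `V`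
and of `W` are related by an integral symplectic congruence. -/
theorem delta_congruence_enlargements {g : ℕ}
    (V W : Matrix (Fin (2*g)) (Fin (2*g)) ℚ)
    (hV : IsSeifert V) (hW : IsSeifert W)
    (n : ℚ) (hn : ∃ m : ℕ, 0 < m ∧ (n = (m : ℚ) ∨ n = ((m : ℚ))⁻¹))
    (hcong : W = Delta g n * V * Delta g n) :
    ∃ (Vt Wt P : Matrix (Fin (2*(g+1))) (Fin (2*(g+1))) ℚ),
      IsEnlargement V Vt ∧ IsEnlargement W Wt ∧
      IsIntegralMat P ∧ IsSymplectic P ∧ Wt = P * Vt * Pᵀ := by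
  obtain _ | k := g
  · obtain rfl : W = V := by ext i; exact i.elim0
    refine ⟨rowEnl W 0 0, rowEnl W 0 0, 1, ⟨0, 0, .inl rfl⟩, ⟨0, 0, .inl rfl⟩, ?_, ?_, by simp⟩
    · exact (isIntegralMat_iff 1).mpr ⟨1, by simp⟩
    · simp [IsSymplectic]
  obtain ⟨m, hm, rfl | rfl⟩ := hn
  · have hm' : (m : ℚ) ≠ 0 := by positivity
    have hmul := Delta_mul_Delta_inv hm' (k + 1)
    have hmul' := mul_eq_one_comm.mp hmul
    have hVW : V = Delta (k+1) (m : ℚ)⁻¹ * W * Delta (k+1) (m : ℚ)⁻¹ := by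
      rw [hcong, Matrix.mul_assoc (Delta (k+1) (m : ℚ)), ← Matrix.mul_assoc, hmul',
        Matrix.one_mul, Matrix.mul_assoc, hmul, Matrix.mul_one]
    obtain ⟨x, y, ρ, σ, h⟩ := colEnl_Delta_inv_congr W hW m hm'
    rw [← hVW] at h
    obtain ⟨Q, hQI, hQS, hQ⟩ :=
      (isSymplectic_neighborMat k (m : ℚ)).exists_integral_inverse (isIntegralMat_neighborMat k m)
    refine ⟨_, _, Q, ⟨y, σ, .inr rfl⟩, ⟨x, ρ, .inl rfl⟩, hQI, hQS, ?_⟩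
    have hQt : (neighborMat k (m : ℚ))ᵀ * Qᵀ = 1 := by
      rw [← Matrix.transpose_mul, hQ, Matrix.transpose_one]
    rw [h, Matrix.mul_assoc, Matrix.mul_assoc, hQt, Matrix.mul_one, ← Matrix.mul_assoc, hQ,
      Matrix.one_mul]
  · obtain ⟨x, y, ρ, σ, h⟩ := colEnl_Delta_inv_congr V hV m (by positivity)
    rw [← hcong] at h
    exact ⟨_, _, _, ⟨x, ρ, .inl rfl⟩, ⟨y, σ, .inr rfl⟩, isIntegralMat_neighborMat k m,
      isSymplectic_neighborMat k _, h⟩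
end

section
/- Let g ≥ 1 and let V ∈ M_{2g}(ℚ) be a Seifert matrix with det V = 0. Then there exist an integral symplectic matrix P ∈ M_{2g}(ℤ), a Seifert matrix V' ∈ M_{2g−2}(ℚ), x ∈ ℚ, and ρ ∈ ℚ^{2g−2} such that P V Pᵗ = [[0,0,0],[1,x,ρᵗ],[0,ρ,V']], i.e., P V Pᵗ is a row enlargement of V'. Consequently, every Seifert matrix is rationally S-equivalent to an invertible Seifert matrix. -/
open Matrix

/-- Elementary moves for rational S-equivalence: rational symplectic congruence
and (row or column) enlargement. Reductions are the inverses of enlargements,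
obtained via the symmetric closure. -/
inductive RatStep : (Σ g : ℕ, Matrix (Fin (2*g)) (Fin (2*g)) ℚ) →
    (Σ g : ℕ, Matrix (Fin (2*g)) (Fin (2*g)) ℚ) → Prop
  | congr {g : ℕ} (V P : Matrix (Fin (2*g)) (Fin (2*g)) ℚ) (hP : IsSymplectic P) :
      RatStep ⟨g, V⟩ ⟨g, P * V * Pᵀ⟩
  | row {g : ℕ} (V : Matrix (Fin (2*g)) (Fin (2*g)) ℚ) (x : ℚ) (ρ : Fin (2*g) → ℚ) :
      RatStep ⟨g, V⟩ ⟨g+1, rowEnl V x ρ⟩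
  | col {g : ℕ} (V : Matrix (Fin (2*g)) (Fin (2*g)) ℚ) (x : ℚ) (ρ : Fin (2*g) → ℚ) :
      RatStep ⟨g, V⟩ ⟨g+1, colEnl V x ρ⟩

/-- Rational S-equivalence: the equivalence relation generated by enlargements,
reductions and rational symplectic congruences. -/
def RatSEquiv : (Σ g : ℕ, Matrix (Fin (2*g)) (Fin (2*g)) ℚ) →
    (Σ g : ℕ, Matrix (Fin (2*g)) (Fin (2*g)) ℚ) → Prop :=
  Relation.EqvGen RatStep


section Transvections

variable {g : ℕ}

theorem Jmat_transpose (R : Type*) [CommRing R] (g : ℕ) : (Jmat R g)ᵀ = -Jmat R g := by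
  ext i j
  simp only [Jmat, transpose_apply, Matrix.neg_apply, of_apply]
  split_ifs <;> first | omega | simp

theorem Jmat_map_s15 (g : ℕ) : (Jmat ℤ g).map (Int.cast : ℤ → ℚ) = Jmat ℚ g := by
  ext i j
  simp only [Jmat, map_apply, of_apply]
  split_ifs <;> simp

/-- The symplectic form defined by `Jmat`. -/
def sympForm (x y : Fin (2*g) → ℤ) : ℤ := x ⬝ᵥ (Jmat ℤ g *ᵥ y)

theorem sympForm_add_left (x y z : Fin (2*g) → ℤ) :
    sympForm (x + y) z = sympForm x z + sympForm y z := by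
  simp [sympForm, add_dotProduct]

theorem sympForm_smul_left (c : ℤ) (x z : Fin (2*g) → ℤ) :
    sympForm (c • x) z = c * sympForm x z := by
  rw [sympForm, smul_dotProduct, smul_eq_mul, sympForm]

theorem sympForm_add_right (x y z : Fin (2*g) → ℤ) :
    sympForm x (y + z) = sympForm x y + sympForm x z := by
  simp [sympForm, mulVec_add, dotProduct_add]

theorem sympForm_neg_right (x y : Fin (2*g) → ℤ) :
    sympForm x (-y) = -sympForm x y := by
  simp [sympForm, mulVec_neg, dotProduct_neg]

theorem sympForm_swap (x y : Fin (2*g) → ℤ) : sympForm x y = -sympForm y x := by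
  rw [sympForm, sympForm, dotProduct_comm, ← dotProduct_transpose_mulVec, Jmat_transpose,
    neg_mulVec, dotProduct_neg, neg_neg, dotProduct_comm]

theorem sympForm_self (x : Fin (2*g) → ℤ) : sympForm x x = 0 := by
  have := sympForm_swap x x
  omega

/-- The matrix of the transvection `x ↦ x + c ω(x, w) w` acting on row vectors. -/
def transvectionMat (c : ℤ) (w : Fin (2*g) → ℤ) : Matrix (Fin (2*g)) (Fin (2*g)) ℤ :=
  1 + c • vecMulVec (Jmat ℤ g *ᵥ w) w

theorem vecMul_transvectionMat (c : ℤ) (w x : Fin (2*g) → ℤ) :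
    x ᵥ* transvectionMat c w = x + (c * sympForm x w) • w := by
  rw [transvectionMat, vecMul_add, vecMul_one, vecMul_smul, vecMul_vecMulVec, smul_smul, sympForm]

theorem isSymplectic_transvectionMat (c : ℤ) (w : Fin (2*g) → ℤ) :
    IsSymplectic (transvectionMat c w) := by
  have h1 : w ᵥ* Jmat ℤ g = -(Jmat ℤ g *ᵥ w) := by
    rw [← mulVec_transpose, Jmat_transpose, neg_mulVec]
  have h2 : (Jmat ℤ g *ᵥ w) ⬝ᵥ w = 0 := by rw [dotProduct_comm]; exact sympForm_self w
  simp only [IsSymplectic, transvectionMat, transpose_add, transpose_one, transpose_smul,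
    transpose_vecMulVec, add_mul, mul_add, one_mul, mul_one, Matrix.smul_mul, Matrix.mul_smul,
    vecMulVec_mul, mul_vecMulVec, h1, vecMulVec_mulVec, vecMulVec_neg, neg_mulVec, smul_mulVec, smul_neg, h2]
  simp

/-- `v` is the image of `y` under an integral symplectic matrix. -/
def SympOrbit (v y : Fin (2*g) → ℤ) : Prop :=
  ∃ P : Matrix (Fin (2*g)) (Fin (2*g)) ℤ, IsSymplectic P ∧ v = y ᵥ* P

theorem SympOrbit.refl (v : Fin (2*g) → ℤ) : SympOrbit v v :=
  ⟨1, by simp [IsSymplectic], by simp⟩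

theorem SympOrbit.trans {u v w : Fin (2*g) → ℤ} (h : SympOrbit u v) (h' : SympOrbit v w) :
    SympOrbit u w := by
  obtain ⟨P, hP, rfl⟩ := h
  obtain ⟨Q, hQ, rfl⟩ := h'
  refine ⟨Q * P, ?_, by rw [vecMul_vecMul]⟩
  unfold IsSymplectic at *
  calc Q * P * Jmat ℤ g * (Q * P)ᵀ = Q * (P * Jmat ℤ g * Pᵀ) * Qᵀ := by
        simp only [transpose_mul, Matrix.mul_assoc]
    _ = Jmat ℤ g := by rw [hP, hQ]

theorem SympOrbit.smul {u v : Fin (2*g) → ℤ} (h : SympOrbit u v) (d : ℤ) :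
    SympOrbit (d • u) (d • v) := by
  obtain ⟨P, hP, rfl⟩ := h
  exact ⟨P, hP, by rw [smul_vecMul]⟩

theorem SympOrbit.transvection (v : Fin (2*g) → ℤ) (c : ℤ) (w : Fin (2*g) → ℤ) :
    SympOrbit v (v + (c * sympForm v w) • w) := by
  refine ⟨transvectionMat (-c) w, isSymplectic_transvectionMat _ _, ?_⟩
  rw [vecMul_transvectionMat, sympForm_add_left, sympForm_smul_left, sympForm_self]
  module

theorem SympOrbit.of_isUnit_sympForm {u w : Fin (2*g) → ℤ} (h : IsUnit (sympForm u w)) :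
    SympOrbit u w := by
  convert SympOrbit.transvection u (sympForm u w) (u + -w) using 1
  rw [sympForm_add_right, sympForm_self, sympForm_neg_right, zero_add, mul_neg,
    Int.isUnit_mul_self h]
  module

/-- The other index in the `2 × 2` block of `i`. -/
def partner (i : Fin (2*g)) : Fin (2*g) :=
  if _h : i.val % 2 = 0 then ⟨i.val + 1, by omega⟩
  else ⟨i.val - 1, by omega⟩

theorem partner_val (i : Fin (2*g)) :
    (partner i).val = if i.val % 2 = 0 then i.val + 1 else i.val - 1 := by
  unfold partner
  split_ifs <;> rfl

theorem partner_partner (i : Fin (2*g)) : partner (partner i) = i := by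
  apply Fin.ext
  rw [partner_val, partner_val]
  split_ifs <;> omega

theorem isUnit_Jmat_partner (i : Fin (2*g)) : IsUnit (Jmat ℤ g i (partner i)) := by
  have := partner_val i
  simp only [Jmat, of_apply]
  split_ifs at * <;> first | omega | simp

theorem Jmat_eq_zero {i j : Fin (2*g)} (h : i ≠ partner j) : Jmat ℤ g i j = 0 := by
  have := partner_val j
  have h' : i.val ≠ (partner j).val := fun e => h (Fin.ext e)
  simp only [Jmat, of_apply]
  split_ifs at * <;> omega

theorem sympForm_single_right (x : Fin (2*g) → ℤ) (j : Fin (2*g)) :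
    sympForm x (Pi.single j 1) = x (partner j) * Jmat ℤ g (partner j) j := by
  rw [sympForm, mulVec_single_one, dotProduct, Finset.sum_eq_single (partner j)]
  · rfl
  · intro i _ hi
    simp [col, Jmat_eq_zero hi]
  · simp

theorem isUnit_Jmat_partner_left (i : Fin (2*g)) : IsUnit (Jmat ℤ g (partner i) i) := by
  simpa [partner_partner] using isUnit_Jmat_partner (partner i)

theorem SympOrbit.single (i j : Fin (2*g)) :
    SympOrbit (Pi.single i 1 : Fin (2*g) → ℤ) (Pi.single j 1) := by
  by_cases hij : i = j
  · subst hij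
    exact .refl _
  by_cases hp : i = partner j
  · apply SympOrbit.of_isUnit_sympForm
    rw [sympForm_single_right, hp]
    simpa using isUnit_Jmat_partner_left j
  refine .trans (v := Pi.single (partner i) 1 + Pi.single (partner j) 1)
    (.of_isUnit_sympForm ?_) (.of_isUnit_sympForm ?_)
  · rw [sympForm_add_right, sympForm_single_right, sympForm_single_right, partner_partner,
      partner_partner, Pi.single_eq_same, Pi.single_eq_of_ne (Ne.symm hij)]
    simpa using isUnit_Jmat_partner i
  · rw [sympForm_single_right, Pi.add_apply, Pi.single_eq_same, Pi.single_eq_of_ne]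
    · simpa using isUnit_Jmat_partner_left j
    · intro h
      exact hij (by rw [← partner_partner i, ← h, partner_partner])

/-- Any coordinate can be changed by a multiple of another one within the orbit. -/
theorem SympOrbit.exists_add_mul (y : Fin (2*g) → ℤ) {i j : Fin (2*g)} (hij : j ≠ i) (c : ℤ) :
    ∃ z, SympOrbit y z ∧ z j = y j + c * y i := by
  have hu := Int.isUnit_mul_self (isUnit_Jmat_partner i)
  set ε := Jmat ℤ g i (partner i)
  have hB : ∀ x : Fin (2*g) → ℤ, sympForm x (Pi.single (partner i) 1) = x i * ε := by
    intro x
    rw [sympForm_single_right, partner_partner]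
  by_cases hp : j = partner i
  · refine ⟨_, .transvection y (c * ε) (Pi.single (partner i) 1), ?_⟩
    rw [hB, hp]
    simp only [Pi.add_apply, Pi.smul_apply, Pi.single_eq_same, smul_eq_mul]
    linear_combination c * y i * hu
  · refine ⟨_, .trans (.transvection y (-(c * ε)) (Pi.single j 1))
      (.transvection _ (c * ε) (Pi.single (partner i) 1 + Pi.single j 1)), ?_⟩
    have hji : (Pi.single j 1 : Fin (2*g) → ℤ) i = 0 := Pi.single_eq_of_ne (Ne.symm hij) _
    have hjp : (Pi.single (partner i) 1 : Fin (2*g) → ℤ) j = 0 := Pi.single_eq_of_ne hp _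
    simp only [Pi.add_apply, Pi.smul_apply, Pi.single_eq_same, smul_eq_mul, hji, hjp,
      sympForm_add_right, sympForm_add_left, sympForm_smul_left, hB, sympForm_self]
    linear_combination c * y i * hu

/-- Every integral vector is a multiple of a row of an integral symplectic matrix. -/
theorem SympOrbit.exists_smul_single (v : Fin (2*g) → ℤ) (hv : v ≠ 0) (k : Fin (2*g)) :
    ∃ d : ℤ, d ≠ 0 ∧ SympOrbit v (d • Pi.single k 1) := by
  classical
  have hex : ∃ n : ℕ, ∃ y i, SympOrbit v y ∧ y i ≠ 0 ∧ (y i).natAbs = n := by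
    obtain ⟨i, hi⟩ := Function.ne_iff.mp hv
    exact ⟨_, v, i, .refl v, hi, rfl⟩
  obtain ⟨y, i, hy, hi, hn⟩ := Nat.find_spec hex
  have hdvd : ∀ j, y i ∣ y j := by
    intro j
    by_cases hij : j = i
    · rw [hij]
    obtain ⟨z, hz, hzj⟩ := SympOrbit.exists_add_mul y hij (-(y j / y i))
    have hzj' : z j = y j % y i := by
      rw [hzj, Int.emod_def]
      ring
    by_contra hnd
    have h0 : z j ≠ 0 := by
      rw [hzj']
      exact fun h => hnd (Int.dvd_of_emod_eq_zero h)
    have hle := Nat.find_min' hex ⟨z, j, hy.trans hz, h0, rfl⟩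
    rw [← hn, hzj'] at hle
    have := Int.emod_lt (y j) hi
    have := Int.emod_nonneg (y j) hi
    omega
  choose u hu using hdvd
  have hyu : y = y i • u := by
    ext j
    exact hu j
  have hui : u i = 1 := by
    have := hu i
    exact mul_left_cancel₀ hi (by linarith)
  refine ⟨y i, hi, hy.trans ?_⟩
  rw [hyu]
  have hone : (y i • u) i = y i := by simp [hui]
  rw [hone]
  refine SympOrbit.smul (.trans (.of_isUnit_sympForm ?_) (.single (partner i) k)) _
  rw [sympForm_single_right, partner_partner, hui, one_mul]
  exact isUnit_Jmat_partner i

end Transvections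

theorem IsSeifert.congr {g : ℕ} {V P : Matrix (Fin (2*g)) (Fin (2*g)) ℚ} (hV : IsSeifert V)
    (hP : IsSymplectic P) : IsSeifert (P * V * Pᵀ) := by
  unfold IsSeifert IsSymplectic at *
  rw [← hV] at hP ⊢
  rw [← hP]
  simp only [transpose_mul, transpose_transpose, Matrix.mul_sub, Matrix.sub_mul, Matrix.mul_assoc]

/-- A Seifert matrix with vanishing first row is a row enlargement. -/
theorem IsSeifert.exists_eq_rowEnl {g : ℕ} {W : Matrix (Fin (2*(g+1))) (Fin (2*(g+1))) ℚ}
    (hW : IsSeifert W) (h0 : ∀ j, W ⟨0, by omega⟩ j = 0) :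
    ∃ (V' : Matrix (Fin (2*g)) (Fin (2*g)) ℚ) (x : ℚ) (ρ : Fin (2*g) → ℚ),
      IsSeifert V' ∧ W = rowEnl V' x ρ := by
  have hJ : ∀ i j, W i j - W j i = Jmat ℚ (g+1) i j := fun i j => congrFun (congrFun hW i) j
  refine ⟨of fun i j => W ⟨i.val + 2, by omega⟩ ⟨j.val + 2, by omega⟩,
    W ⟨1, by omega⟩ ⟨1, by omega⟩, fun j => W ⟨1, by omega⟩ ⟨j.val + 2, by omega⟩, ?_, ?_⟩
  · ext i j
    simp only [Matrix.sub_apply, transpose_apply, of_apply, hJ, Jmat, Nat.add_mod_right]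
    congr 1
    · simp only [eq_iff_iff]; omega
    · congr 1
      simp only [eq_iff_iff]; omega
  · ext ⟨i, hi⟩ ⟨j, hj⟩
    have key := hJ ⟨i, hi⟩ ⟨j, hj⟩
    rcases i with _ | _ | i
    · simpa [rowEnl] using h0 ⟨j, hj⟩
    · rcases j with _ | _ | j
      · rw [h0] at key
        simpa [-Fin.mk_one, -Fin.zero_eta, rowEnl, Jmat] using key
      · simp [-Fin.mk_one, -Fin.zero_eta, rowEnl]
      · simp [-Fin.mk_one, -Fin.zero_eta, rowEnl]
    · rcases j with _ | _ | j
      · rw [h0] at key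
        simpa [-Fin.mk_one, -Fin.zero_eta, rowEnl, Jmat] using key
      · simpa [-Fin.mk_one, -Fin.zero_eta, rowEnl, Jmat, sub_eq_zero] using key
      · simp [-Fin.mk_one, -Fin.zero_eta, rowEnl]

theorem IsSeifert.exists_congr_rowEnl {g : ℕ} {V : Matrix (Fin (2*(g+1))) (Fin (2*(g+1))) ℚ}
    (hV : IsSeifert V) (hdet : V.det = 0) :
    ∃ P : Matrix (Fin (2*(g+1))) (Fin (2*(g+1))) ℚ, IsIntegralMat P ∧ IsSymplectic P ∧
      ∃ (V' : Matrix (Fin (2*g)) (Fin (2*g)) ℚ) (x : ℚ) (ρ : Fin (2*g) → ℚ),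
        IsSeifert V' ∧ P * V * Pᵀ = rowEnl V' x ρ := by
  obtain ⟨v, hv, hvV⟩ := exists_vecMul_eq_zero_iff.mpr hdet
  obtain ⟨b, hb⟩ := IsLocalization.exist_integer_multiples_of_finite (nonZeroDivisors ℤ) v
  choose z hz using hb
  have hzv : (fun i => (z i : ℚ)) = (b : ℤ) • v := by
    ext i
    simpa using hz i
  have hb0 : (b : ℤ) ≠ 0 := nonZeroDivisors.coe_ne_zero b
  have hz0 : z ≠ 0 := by
    rintro rfl
    apply smul_ne_zero hb0 hv
    rw [← hzv]
    ext i
    simp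
  obtain ⟨d, hd, P, hP, hzP⟩ := SympOrbit.exists_smul_single z hz0 ⟨0, by omega⟩
  have hsymp : IsSymplectic (P.map (Int.cast : ℤ → ℚ)) := by
    have := congrArg (fun M => M.map (Int.castRingHom ℚ)) hP
    simp only [Matrix.map_mul] at this
    have hmap : (Jmat ℤ (g+1)).map (Int.castRingHom ℚ) = Jmat ℚ (g+1) := Jmat_map_s15 (g+1)
    rw [hmap, transpose_map] at this
    exact this
  refine ⟨P.map Int.cast, fun i j => ⟨P i j, rfl⟩, hsymp, ?_⟩
  apply (hV.congr hsymp).exists_eq_rowEnl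
  have hrow : (b : ℤ) • v = (d : ℚ) • (P.map (Int.cast : ℤ → ℚ)).row ⟨0, by omega⟩ := by
    rw [← hzv, hzP, smul_vecMul, single_one_vecMul]
    ext i
    simp [row]
  have hker : (P.map (Int.cast : ℤ → ℚ)).row ⟨0, by omega⟩ ᵥ* V = 0 := by
    have h : ((b : ℤ) • v) ᵥ* V = 0 := by rw [smul_vecMul, hvV, smul_zero]
    rw [hrow, smul_vecMul] at h
    exact (smul_eq_zero.mp h).resolve_left (by exact_mod_cast hd)
  intro j
  rw [mul_apply]
  apply Finset.sum_eq_zero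
  intro k _
  rw [mul_apply_eq_vecMul]
  have := congrFun hker k
  simp only [row] at this
  rw [this]
  simp

/-- from the proof of Proposition `propSeq`: a non-invertible Seifert
matrix is integrally symplectically congruent to a row enlargement; consequently every
Seifert matrix is rationally S-equivalent to an invertible one. -/
theorem noninvertible_seifert_reduces :
    (∀ (g : ℕ) (V : Matrix (Fin (2*(g+1))) (Fin (2*(g+1))) ℚ),
      IsSeifert V → V.det = 0 →
      ∃ P : Matrix (Fin (2*(g+1))) (Fin (2*(g+1))) ℚ, IsIntegralMat P ∧ IsSymplectic P ∧
        ∃ (V' : Matrix (Fin (2*g)) (Fin (2*g)) ℚ) (x : ℚ) (ρ : Fin (2*g) → ℚ),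
          IsSeifert V' ∧ P * V * Pᵀ = rowEnl V' x ρ) ∧
    (∀ (g : ℕ) (V : Matrix (Fin (2*g)) (Fin (2*g)) ℚ), IsSeifert V →
      ∃ (h : ℕ) (W : Matrix (Fin (2*h)) (Fin (2*h)) ℚ),
        IsSeifert W ∧ IsUnit W.det ∧ RatSEquiv ⟨g, V⟩ ⟨h, W⟩) := by
  refine ⟨fun g V hV hdet => hV.exists_congr_rowEnl hdet, fun g => ?_⟩
  induction g with
  | zero => exact fun V hV => ⟨0, V, hV, by simp, .refl _⟩
  | succ g ih =>
    intro V hV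
    by_cases hdet : V.det = 0
    · obtain ⟨P, -, hP, V', x, ρ, hV', h⟩ := hV.exists_congr_rowEnl hdet
      obtain ⟨n, W, hW, hWdet, hVW⟩ := ih V' hV'
      have hcongr : RatSEquiv ⟨g + 1, V⟩ ⟨g + 1, P * V * Pᵀ⟩ := .rel _ _ (.congr V P hP)
      rw [h] at hcongr
      exact ⟨n, W, hW, hWdet, hcongr.trans _ _ _
        (.trans _ _ _ (.symm _ _ (.rel _ _ (.row V' x ρ))) hVW)⟩
    · exact ⟨g + 1, V, hV, isUnit_iff_ne_zero.mpr hdet, .refl _⟩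
end
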